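/- Let T₀ > e, let φ : [T₀, ∞) → ℝ be a strictly increasing continuous function, and let w : [T₀, ∞) → [0, ∞) be locally integrable with the substitution property: for all real A < B in the range of φ and every Lebesgue-integrable f on [A, B], ∫_{φ⁻¹(A)}^{φ⁻¹(B)} f(φ(t))·w(t) dt = ∫_A^B f(x) dx. Let g : (0, ∞) → ℝ be continuous and let f : (0, ∞) → ℝ be differentiable with f′ = −g and f(x) = √(2/(πx))·cos(x − π/4) + O(x^{−3/2}) as x → ∞. Let (t_ν)_{ν≥1} be a sequence with t_ν > e, t_ν → ∞, lying in the range of φ, and satisfying the Titchmarsh gap asymptotic: there exist C > 0 and ν₀ such that for all ν ≥ ν₀, |t_{ν+1} − t_ν − 2π/log t_ν − 2π·log(2π)/log² t_ν| ≤ C/log³ t_ν. Then ∫_{φ⁻¹(t_ν)}^{φ⁻¹(t_{ν+1})} g(φ(t))·w(t) dt = (2√(2π)/(√t_ν · log t_ν))·sin(t_ν − π/4) + O(1/(√t_ν · log² t_ν)); that is, there exist C′ > 0 and ν₁ such that for all ν ≥ ν₁ the absolute difference of the two sides is at most C′/(√t_ν · log² t_ν). (This is formula (3.9) of the paper, where φ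 = φ₁ is the Jacob's ladder, w = Z̃², f = J₀, g = J₁, and (t_ν) is the Gram sequence.) -/

import Mathlib

open Real MeasureTheory

/-- Second-order Taylor bound for the increment of the cosine. -/
theorem abs_cos_sub_cos_add_sub_le (θ h : ℝ) (h0 : 0 < h) (h1 : h ≤ 1) :
    |cos θ - cos (θ + h) - h * sin θ| ≤ h ^ 2 := by
  have hc := one_sub_sq_div_two_le_cos (x := h)
  have hs := sin_gt_sub_cube h0
  have hs' := sin_lt h0
  have hcube : h ^ 3 ≤ h ^ 2 := pow_le_pow_of_le_one h0.le h1 (by norm_num)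
  have e : cos θ - cos (θ + h) - h * sin θ = cos θ * (1 - cos h) + sin θ * (sin h - h) := by
    rw [cos_add]; ring
  have b1 : |cos θ * (1 - cos h)| ≤ 1 * (h ^ 2 / 2) := by
    rw [abs_mul]
    refine mul_le_mul (abs_cos_le_one θ) ?_ (abs_nonneg _) zero_le_one
    rw [abs_of_nonneg (by linarith [cos_le_one h])]
    linarith
  have b2 : |sin θ * (sin h - h)| ≤ 1 * (h ^ 2 / 2) := by
    rw [abs_mul]
    refine mul_le_mul (abs_sin_le_one θ) ?_ (abs_nonneg _) zero_le_one
    rw [abs_le]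
    constructor <;> linarith [sq_nonneg h]
  rw [e]
  linarith [abs_add_le (cos θ * (1 - cos h)) (sin θ * (sin h - h))]

theorem inv_sqrt_sub_inv_sqrt_le {a b : ℝ} (ha : 0 < a) (hab : a ≤ b) :
    (√a)⁻¹ - (√b)⁻¹ ≤ (√a)⁻¹ * ((b - a) / a) := by
  have hb : 0 < b := ha.trans_le hab
  have hsa : 0 < √a := sqrt_pos.2 ha
  have hsb : 0 < √b := sqrt_pos.2 hb
  have hle : √a ≤ √b := sqrt_le_sqrt hab
  have key : 1 - √a / √b ≤ (b - a) / a := by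
    rw [one_sub_div hsb.ne', div_le_div_iff₀ hsb ha]
    have e : b - a = (√b - √a) * (√b + √a) := by
      nlinarith [sq_sqrt ha.le, sq_sqrt hb.le]
    rw [e, mul_assoc]
    refine mul_le_mul_of_nonneg_left ?_ (sub_nonneg.2 hle)
    nlinarith [sq_sqrt ha.le]
  calc (√a)⁻¹ - (√b)⁻¹ = (√a)⁻¹ * (1 - √a / √b) := by field_simp
    _ ≤ _ := mul_le_mul_of_nonneg_left key (inv_nonneg.2 hsa.le)

/-- Increment of a function with the Bessel asymptotic over a short interval `[a, b]` whose
length is `2π / L` up to `D / L²`. -/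
theorem abs_sub_sub_main_le {f : ℝ → ℝ} {a b K D L : ℝ} (ha : 0 < a) (hab : a < b)
    (hb1 : b - a ≤ 1) (hL : 1 ≤ L) (hLa : L ^ 2 ≤ a) (hD : 0 ≤ D) (hK : 0 ≤ K)
    (hgap : |b - a - 2 * π / L| ≤ D / L ^ 2)
    (hf : ∀ x, a ≤ x → |f x - √(2 / (π * x)) * cos (x - π / 4)| ≤ K * x ^ (-(3 : ℝ) / 2)) :
    |f a - f b - 2 * √(2 * π) / (√a * L) * sin (a - π / 4)|
      ≤ (√(2 / π) * ((2 * π + D) ^ 2 + D + 1) + 2 * K) / (√a * L ^ 2) := by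
  have hL0 : 0 < L := by linarith
  have hb : 0 < b := ha.trans hab
  have hsa : 0 < √a := sqrt_pos.2 ha
  set c := √(2 / π) with hc
  have hc0 : 0 ≤ c := sqrt_nonneg _
  set s := (√a)⁻¹ with hs
  set r := (√b)⁻¹ with hr
  have hs0 : 0 < s := inv_pos.2 hsa
  set q := (L ^ 2)⁻¹ with hq
  have hq0 : 0 < q := by positivity
  have hsplit : ∀ x, √(2 / (π * x)) = c * (√x)⁻¹ := fun x ↦ by
    rw [hc, ← div_div, sqrt_div (by positivity), div_eq_mul_inv]
  have hpow : a ^ (-(3 : ℝ) / 2) ≤ s * q := by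
    have e : a ^ (-(3 : ℝ) / 2) = s * a⁻¹ := by
      rw [show (-(3 : ℝ) / 2) = -(1 / 2) + -1 by norm_num, rpow_add ha, rpow_neg ha.le,
        ← sqrt_eq_rpow, rpow_neg_one]
    rw [e]
    exact mul_le_mul_of_nonneg_left (inv_anti₀ (by positivity) hLa) hs0.le
  have hpowb : b ^ (-(3 : ℝ) / 2) ≤ s * q :=
    (rpow_le_rpow_of_nonpos ha hab.le (by norm_num)).trans hpow
  have hfa := (hf a le_rfl).trans (mul_le_mul_of_nonneg_left hpow hK)
  have hfb := (hf b hab.le).trans (mul_le_mul_of_nonneg_left hpowb hK)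
  rw [hsplit] at hfa hfb
  have hgap' : |b - a - 2 * π / L| ≤ D * q := by rwa [hq, ← div_eq_mul_inv]
  have hlen : (b - a) ^ 2 ≤ (2 * π + D) ^ 2 * q := by
    have h1 : b - a ≤ (2 * π + D) / L := by
      have h2 : D / L ^ 2 ≤ D / L :=
        div_le_div_of_nonneg_left hD hL0 (le_self_pow₀ hL two_ne_zero)
      rw [add_div]
      linarith [le_abs_self (b - a - 2 * π / L)]
    calc (b - a) ^ 2 ≤ ((2 * π + D) / L) ^ 2 := pow_le_pow_left₀ (by linarith) h1 2
      _ = _ := by rw [div_pow, hq, div_eq_mul_inv]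
  have hcos : |cos (a - π / 4) - cos (b - π / 4) - (b - a) * sin (a - π / 4)|
      ≤ (2 * π + D) ^ 2 * q := by
    have := abs_cos_sub_cos_add_sub_le (a - π / 4) (b - a) (by linarith) hb1
    rw [show a - π / 4 + (b - a) = b - π / 4 by ring] at this
    exact this.trans hlen
  have hsin : |(b - a - 2 * π / L) * sin (a - π / 4)| ≤ D * q := by
    rw [abs_mul]
    exact (mul_le_of_le_one_right (abs_nonneg _) (abs_sin_le_one _)).trans hgap'
  have hroot : |(s - r) * cos (b - π / 4)| ≤ s * q := by
    rw [abs_mul]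
    refine (mul_le_of_le_one_right (abs_nonneg _) (abs_cos_le_one _)).trans ?_
    have hrs : r ≤ s := inv_anti₀ hsa (sqrt_le_sqrt hab.le)
    rw [abs_of_nonneg (sub_nonneg.2 hrs)]
    refine (inv_sqrt_sub_inv_sqrt_le ha hab.le).trans (mul_le_mul_of_nonneg_left ?_ hs0.le)
    calc (b - a) / a ≤ 1 / L ^ 2 := div_le_div₀ zero_le_one hb1 (by positivity) hLa
      _ = q := one_div _
  have hmain : 2 * √(2 * π) / (√a * L) = c * s * (2 * π / L) := by
    have e : √(2 * π) = c * π := by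
      rw [hc, ← sqrt_sq pi_pos.le, ← sqrt_mul (by positivity), sqrt_sq pi_pos.le]
      congr 1
      field_simp
    rw [e, hs]
    field_simp
  have hdecomp : f a - f b - 2 * √(2 * π) / (√a * L) * sin (a - π / 4)
      = (f a - c * s * cos (a - π / 4)) - (f b - c * r * cos (b - π / 4))
        + (c * s * ((cos (a - π / 4) - cos (b - π / 4) - (b - a) * sin (a - π / 4))
            + (b - a - 2 * π / L) * sin (a - π / 4))
          + c * ((s - r) * cos (b - π / 4))) := by
    rw [hmain]; ring
  have hrhs : (c * ((2 * π + D) ^ 2 + D + 1) + 2 * K) / (√a * L ^ 2)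
      = (K * (s * q) + K * (s * q))
        + (c * s * ((2 * π + D) ^ 2 * q + D * q) + c * (s * q)) := by
    rw [div_eq_mul_inv, mul_inv]; ring
  rw [hdecomp, hrhs]
  refine (abs_add_le _ _).trans (add_le_add ((abs_sub _ _).trans (add_le_add hfa hfb)) ?_)
  refine (abs_add_le _ _).trans (add_le_add ?_ ?_)
  · rw [abs_mul, abs_of_nonneg (by positivity : 0 ≤ c * s)]
    exact mul_le_mul_of_nonneg_left
      ((abs_add_le _ _).trans (add_le_add hcos hsin)) (by positivity)
  · rw [abs_mul, abs_of_nonneg hc0]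
    exact mul_le_mul_of_nonneg_left hroot hc0

/-- Formula (3.9): with `φ` the Jacob's ladder (abstracted, with inverse `ψ` and weight `w`
satisfying the substitution property (3.2)), `f` satisfying the Bessel asymptotic with
`f' = −g`, and `(t_ν)` a Gram-like sequence satisfying the Titchmarsh gap asymptotic,
`∫_{φ⁻¹(t_ν)}^{φ⁻¹(t_{ν+1})} g(φ(t)) w(t) dt
  = (2√(2π)/(√t_ν log t_ν)) sin(t_ν − π/4) + O(1/(√t_ν log² t_ν))`. -/
theorem integral_ladder_gram_asymptotic
    (T₀ : ℝ) (hT₀ : Real.exp 1 < T₀)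
    (φ ψ w : ℝ → ℝ)
    (hφ_mono : StrictMonoOn φ (Set.Ici T₀))
    (hφ_cont : ContinuousOn φ (Set.Ici T₀))
    (hw_nonneg : ∀ s ∈ Set.Ici T₀, 0 ≤ w s)
    (hw_loc : LocallyIntegrableOn w (Set.Ici T₀))
    (hψ : ∀ s ∈ Set.Ici T₀, ψ (φ s) = s)
    (hsub : ∀ A B : ℝ, A < B → A ∈ φ '' Set.Ici T₀ → B ∈ φ '' Set.Ici T₀ →
      ∀ f : ℝ → ℝ, IntegrableOn f (Set.Icc A B) →
        ∫ s in ψ A..ψ B, f (φ s) * w s = ∫ x in A..B, f x)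
    (f g : ℝ → ℝ)
    (hg_cont : ContinuousOn g (Set.Ioi (0:ℝ)))
    (hf_deriv : ∀ x > (0:ℝ), HasDerivAt f (-(g x)) x)
    (hf_asymp : ∃ K : ℝ, ∃ x₀ : ℝ, ∀ x ≥ x₀,
      |f x - Real.sqrt (2 / (Real.pi * x)) * Real.cos (x - Real.pi / 4)|
        ≤ K * x ^ (-(3:ℝ)/2))
    (t : ℕ → ℝ) (ht : ∀ ν, Real.exp 1 < t ν)
    (htend : Filter.Tendsto t Filter.atTop Filter.atTop)
    (htr : ∀ ν, t ν ∈ φ '' Set.Ici T₀)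
    (hgap : ∃ C > (0:ℝ), ∃ ν₀ : ℕ, ∀ ν ≥ ν₀,
      |t (ν + 1) - t ν - 2 * Real.pi / Real.log (t ν)
        - 2 * Real.pi * Real.log (2 * Real.pi) / (Real.log (t ν)) ^ 2|
        ≤ C / (Real.log (t ν)) ^ 3) :
    ∃ C' > (0:ℝ), ∃ ν₁ : ℕ, ∀ ν ≥ ν₁,
      |(∫ s in ψ (t ν)..ψ (t (ν + 1)), g (φ s) * w s)
        - (2 * Real.sqrt (2 * Real.pi) / (Real.sqrt (t ν) * Real.log (t ν)))
          * Real.sin (t ν - Real.pi / 4)|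
        ≤ C' / (Real.sqrt (t ν) * (Real.log (t ν)) ^ 2) := by
  obtain ⟨K, x₀, hf⟩ := hf_asymp
  obtain ⟨C, hC, ν₀, hgap⟩ := hgap
  set M := 2 * π * log (2 * π) with hM
  have hM0 : 0 ≤ M := mul_nonneg (by positivity) (log_nonneg (by linarith [pi_gt_three]))
  have hlog : Filter.Tendsto (fun ν ↦ log (t ν)) Filter.atTop Filter.atTop :=
    tendsto_log_atTop.comp htend
  have hsq : ∀ᶠ x : ℝ in Filter.atTop, log x ^ 2 ≤ x := by
    filter_upwards [(isLittleO_pow_log_id_atTop (n := 2)).bound zero_lt_one,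
      Filter.eventually_ge_atTop 0] with x hx hx0
    simpa [abs_of_nonneg hx0] using hx
  refine ⟨√(2 / π) * ((2 * π + (M + C)) ^ 2 + (M + C) + 1) + 2 * |K|, by positivity, ?_⟩
  rw [← Filter.eventually_atTop]
  filter_upwards [Filter.eventually_ge_atTop ν₀, htend.eventually_ge_atTop x₀,
    hlog.eventually_ge_atTop 1, hlog.eventually_ge_atTop C,
    hlog.eventually_ge_atTop (2 * π + (M + C)), htend.eventually hsq] with ν hν hx hL hLC hLH hLt
  have ha : 0 < t ν := (exp_pos 1).trans (ht ν)
  replace hgap := hgap ν hν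
  set a := t ν
  set b := t (ν + 1)
  set L := log a
  have hL0 : 0 < L := by linarith
  have hC3 : C / L ^ 3 ≤ C / L ^ 2 :=
    div_le_div_of_nonneg_left hC.le (by positivity) (pow_le_pow_right₀ hL (by norm_num))
  have hML : 0 ≤ M / L ^ 2 := by positivity
  have hgapD : |b - a - 2 * π / L| ≤ (M + C) / L ^ 2 := by
    rw [add_div]
    calc |b - a - 2 * π / L| = |(b - a - 2 * π / L - M / L ^ 2) + M / L ^ 2| := by ring_nf
      _ ≤ |b - a - 2 * π / L - M / L ^ 2| + |M / L ^ 2| := abs_add_le _ _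
      _ ≤ _ := by rw [abs_of_nonneg hML]; linarith
  have hab : a < b := by
    have h1 : C / L ^ 2 ≤ 1 / L := by
      rw [div_le_div_iff₀ (by positivity) hL0]
      nlinarith
    have h2 : 1 / L < 2 * π / L := div_lt_div_of_pos_right (by linarith [pi_gt_three]) hL0
    linarith [neg_le_of_abs_le hgap]
  have hb1 : b - a ≤ 1 := by
    have h1 : (M + C) / L ^ 2 ≤ (M + C) / L :=
      div_le_div_of_nonneg_left (by positivity) hL0 (le_self_pow₀ hL two_ne_zero)
    have h2 : (2 * π + (M + C)) / L ≤ 1 := (div_le_one hL0).2 hLH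
    rw [add_div] at h2
    linarith [le_of_abs_le hgapD]
  have hg : ContinuousOn g (Set.Icc a b) := hg_cont.mono fun x hx ↦ ha.trans_le hx.1
  have hint : ∫ s in ψ a..ψ b, g (φ s) * w s = f a - f b := by
    rw [hsub a b hab (htr ν) (htr (ν + 1)) g hg.integrableOn_Icc,
      intervalIntegral.integral_eq_sub_of_hasDerivAt (f := -f)]
    · simp only [Pi.neg_apply]; ring
    · intro x hx
      rw [Set.uIcc_of_le hab.le] at hx
      simpa using (hf_deriv x (ha.trans_le hx.1)).neg
    · exact hg.intervalIntegrable_of_Icc hab.le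
  rw [hint]
  refine abs_sub_sub_main_le ha hab hb1 hL hLt (by positivity) (abs_nonneg K) hgapD ?_
  intro x hax
  exact (hf x (hx.trans hax)).trans
    (mul_le_mul_of_nonneg_right (le_abs_self K) (rpow_nonneg (ha.le.trans hax) _))
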